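/- The map ζ : P_{m,n,d} → P_{m,n,d}, defined so that ζ(type(A)) = cotype(A) for every EL-chart A (well-defined since the type induces a bijection from equivalence classes of EL-charts onto P_{m,n,d} and type and cotype are invariant under equivalence), is a bijection. -/

import Mathlib

namespace ELChart

/-- An EL-chart (for parameters `d`, `n` and `mfun τ = m_τ`): a non-empty subset
`A ⊆ ℤ^(d) = (ℤ/dℤ) × ℤ` which is bounded below and satisfies `f(A) ⊆ A` and `A + n ⊆ A`,
where `f (τ, x) = (τ + 1, x + m_τ)`. -/
def IsChart (d n : ℕ) (mfun : ZMod d → ℤ) (A : Set (ZMod d × ℤ)) : Prop :=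
  A.Nonempty ∧ (∃ c : ℤ, ∀ p ∈ A, c ≤ p.2) ∧
    (∀ p ∈ A, ((p.1 + 1 : ZMod d), p.2 + mfun p.1) ∈ A) ∧
    (∀ p ∈ A, (p.1, p.2 + (n : ℤ)) ∈ A)

/-- `B = A ∖ (A + n)`. -/
def Bset (d n : ℕ) (A : Set (ZMod d × ℤ)) : Set (ZMod d × ℤ) :=
  {p | p ∈ A ∧ (p.1, p.2 - (n : ℤ)) ∉ A}

/-- The shift `A + z` of a subset of `ℤ^(d)`. -/
def shift (d : ℕ) (A : Set (ZMod d × ℤ)) (z : ℤ) : Set (ZMod d × ℤ) :=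
  (fun p : ZMod d × ℤ => (p.1, p.2 + z)) '' A

/-- Two EL-charts are equivalent if they differ by a shift. -/
def ChartEquiv (d : ℕ) (A A' : Set (ZMod d × ℤ)) : Prop :=
  ∃ z : ℤ, shift d A z = A'

/-- The sequence `b 0, b 1, …` associated with an EL-chart: `b 0 = min B_(0)` and `b (i+1)`
is the unique element of `B` of the form `f (b i) − c * n` with `c` a non-negative integer. -/
noncomputable def bseq (d n : ℕ) (mfun : ZMod d → ℤ) (A : Set (ZMod d × ℤ)) :
    ℕ → ZMod d × ℤ
  | 0 => ((0 : ZMod d), sInf {x : ℤ | ((0 : ZMod d), x) ∈ Bset d n A})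
  | i + 1 =>
    ((bseq d n mfun A i).1 + 1,
      sInf {y : ℤ | ((bseq d n mfun A i).1 + 1, y) ∈ Bset d n A ∧
        ((bseq d n mfun A i).2 + mfun (bseq d n mfun A i).1 - y) % (n : ℤ) = 0 ∧
        y ≤ (bseq d n mfun A i).2 + mfun (bseq d n mfun A i).1})

/-- The entry `μ'_k` (for `1 ≤ k ≤ d*n`) of the type of an EL-chart: the non-negative integer
with `b k = f (b (k-1)) − μ'_k * n`. -/
noncomputable def typeInt (d n : ℕ) (mfun : ZMod d → ℤ) (A : Set (ZMod d × ℤ)) (k : ℕ) : ℤ :=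
  ((bseq d n mfun A (k - 1)).2 + mfun (bseq d n mfun A (k - 1)).1
    - (bseq d n mfun A k).2) / (n : ℤ)

/-- The type of an EL-chart as a tuple: `μ'_{τ,i} = μ'_{τ + (i−1)d}` where the `Fin d`-index
`τ` corresponds to `τ + 1 ∈ {1, …, d}` and the `Fin n`-index `i` to `i + 1 ∈ {1, …, n}`. -/
noncomputable def typeTup (d n : ℕ) (mfun : ZMod d → ℤ) (A : Set (ZMod d × ℤ)) :
    Fin d → Fin n → ℤ :=
  fun τ i => typeInt d n mfun A (τ.val + 1 + i.val * d)

/-- The entry `μ'_{τ',i'}` of the type of an EL-chart attached to an element `p = b_{τ',i'}`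
of `B`: if `q ∈ B` is the (unique) predecessor of `p`, i.e. the element with
`p = f q − c * n` for a non-negative integer `c`, then `muOf p = c`. -/
noncomputable def muOf (d n : ℕ) (mfun : ZMod d → ℤ) (A : Set (ZMod d × ℤ))
    (p : ZMod d × ℤ) : ℤ :=
  (sInf {y : ℤ | ((p.1 - 1 : ZMod d), y) ∈ Bset d n A ∧
      (y + mfun (p.1 - 1) - p.2) % (n : ℤ) = 0 ∧ p.2 ≤ y + mfun (p.1 - 1)}
    + mfun (p.1 - 1) - p.2) / (n : ℤ)

/-- The `i`-th largest element `b̃_{τ,i}` of `B_(τ)` (1-indexed: `i ∈ {1, …, n}`): the unique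
element of `B_(τ)` with exactly `i − 1` elements of `B_(τ)` above it. -/
noncomputable def btilde (d n : ℕ) (A : Set (ZMod d × ℤ)) (τ : ZMod d) (i : ℕ) : ℤ :=
  sInf {y : ℤ | (τ, y) ∈ Bset d n A ∧
    Set.ncard {z : ℤ | (τ, z) ∈ Bset d n A ∧ y < z} = i - 1}

/-- The cotype of an EL-chart as a tuple: `μ̃_{τ,i} = μ'_{τ',i'}` where `b̃_{τ,i} = b_{τ',i'}`,
i.e. the type entry attached to the `i`-th largest element of `B_(τ)`. -/
noncomputable def cotypeTup (d n : ℕ) (mfun : ZMod d → ℤ) (A : Set (ZMod d × ℤ)) :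
    Fin d → Fin n → ℤ :=
  fun τ i =>
    muOf d n mfun A (((τ.val + 1 : ℕ) : ZMod d),
      btilde d n A ((τ.val + 1 : ℕ) : ZMod d) (i.val + 1))

/-- Membership in `P_{m,n,d}`: all entries are non-negative and
`Σ_{i=1}^k Σ_{τ=1}^d μ_{τ,i} ≤ k*m/n` for `k = 1, …, n`, with equality for `k = n`. -/
def memP (d n m : ℕ) (μ : Fin d → Fin n → ℤ) : Prop :=
  (∀ τ i, 0 ≤ μ τ i) ∧
    (∀ k : ℕ, 1 ≤ k → k ≤ n →
      (n : ℤ) * ∑ τ : Fin d, ∑ i : Fin n, (if i.val + 1 ≤ k then μ τ i else 0)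
        ≤ (k : ℤ) * (m : ℤ)) ∧
    (∑ τ : Fin d, ∑ i : Fin n, μ τ i) = (m : ℤ)

/-- An EL-chart is normalised if `Σ_{b ∈ B_(0)} |b| = n(n−1)/2`. -/
def IsNormalised (d n : ℕ) (A : Set (ZMod d × ℤ)) : Prop :=
  ∑ᶠ x ∈ {x : ℤ | ((0 : ZMod d), x) ∈ Bset d n A}, x = ((n * (n - 1) / 2 : ℕ) : ℤ)

/-- The dominant rearrangement of a tuple: each component is sorted weakly decreasingly. -/
def domOf (d n : ℕ) (μ : Fin d → Fin n → ℤ) : Fin d → Fin n → ℤ :=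
  fun τ i => μ τ (Tuple.sort (fun j => -(μ τ j)) i)

/-- A tuple is dominant if each of its `d` components is weakly decreasing. -/
def IsDom (d n : ℕ) (μ : Fin d → Fin n → ℤ) : Prop :=
  ∀ τ : Fin d, ∀ i j : Fin n, i ≤ j → μ τ j ≤ μ τ i

end ELChart

section Sorting

variable {n : ℕ} {α : Type*} [LinearOrder α]

/-- The weakly increasing rearrangement of a finite tuple. -/
def sortTuple (x : Fin n → α) : Fin n → α := x ∘ Tuple.sort x

lemma sortTuple_monotone (x : Fin n → α) : Monotone (sortTuple x) := Tuple.monotone_sort x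

lemma sortTuple_le_iff (x : Fin n → α) (j : Fin n) (a : α) :
    sortTuple x j ≤ a ↔ (j : ℕ) < (Finset.univ.filter fun i => x i ≤ a).card := by
  have hc : (Finset.univ.filter fun i => x i ≤ a).card =
      (Finset.univ.filter fun i => sortTuple x i ≤ a).card := by
    symm
    refine Finset.card_bij (fun i _ => Tuple.sort x i) ?_ ?_ ?_
    · intro i hi
      exact Finset.mem_filter.2 ⟨Finset.mem_univ _, (Finset.mem_filter.1 hi).2⟩
    · intro i _ j _ h
      exact (Tuple.sort x).injective h
    · intro b hb
      refine ⟨(Tuple.sort x).symm b, Finset.mem_filter.2 ⟨Finset.mem_univ _, ?_⟩, by simp⟩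
      have := (Finset.mem_filter.1 hb).2
      rwa [sortTuple, Function.comp_apply, Equiv.apply_symm_apply]
  rw [hc]
  exact (Tuple.lt_card_le_iff_apply_le_of_monotone (sortTuple_monotone x)).symm

lemma sortTuple_le_add {x y : Fin n → ℝ} {δ : ℝ} (h : ∀ i, x i ≤ y i + δ) (j : Fin n) :
    sortTuple x j ≤ sortTuple y j + δ := by
  rw [sortTuple_le_iff]
  refine lt_of_lt_of_le ((sortTuple_le_iff y j (sortTuple y j)).1 le_rfl)
    (Finset.card_le_card fun i hi => ?_)
  simp only [Finset.mem_filter, Finset.mem_univ, true_and] at hi ⊢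
  linarith [h i]

lemma sortTuple_of_monotone {x : Fin n → α} (h : Monotone x) : sortTuple x = x := by
  simp [sortTuple, Tuple.sort_eq_refl_iff_monotone.2 h]

lemma sum_sortTuple {x : Fin n → ℝ} : ∑ i, sortTuple x i = ∑ i, x i :=
  Equiv.sum_comp (Tuple.sort x) x

lemma sortTuple_floor (x : Fin n → ℝ) :
    sortTuple (fun i => ⌊x i⌋) = fun i => ⌊sortTuple x i⌋ :=
  Tuple.unique_monotone (f := fun i => ⌊x i⌋) (Tuple.monotone_sort _)
    (fun _ _ hij => Int.floor_mono (Tuple.monotone_sort x hij))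

/-- If the first `k` entries of `z` lie below the others, their sum is at most that of the
`k` first entries of any rearrangement. -/
lemma sum_initial_le_sum_sortTuple {z : Fin n → ℝ} {k : ℕ} {a : ℝ}
    (h₁ : ∀ i : Fin n, i.val < k → z i ≤ a) (h₂ : ∀ i : Fin n, k ≤ i.val → a ≤ z i) :
    ∑ i : Fin n, (if i.val < k then z i else 0) ≤
      ∑ i : Fin n, (if i.val < k then sortTuple z i else 0) := by
  have key : ∑ i : Fin n, (if i.val < k then z i - a else 0) ≤
      ∑ i : Fin n, (if i.val < k then sortTuple z i - a else 0) := by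
    calc ∑ i : Fin n, (if i.val < k then z i - a else 0)
        = ∑ i : Fin n, min (z i - a) 0 := by
          refine Finset.sum_congr rfl fun i _ => ?_
          split_ifs with hi
          · rw [min_eq_left (by linarith [h₁ i hi])]
          · rw [min_eq_right (by linarith [h₂ i (not_lt.1 hi)])]
      _ = ∑ i : Fin n, min (sortTuple z i - a) 0 :=
          (Equiv.sum_comp (Tuple.sort z) fun i => min (z i - a) 0).symm
      _ ≤ _ := by
          refine Finset.sum_le_sum fun i _ => ?_
          split_ifs
          · exact min_le_left _ _
          · exact min_le_right _ _
  have split : ∀ w : Fin n → ℝ, ∑ i : Fin n, (if i.val < k then w i - a else 0) =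
      ∑ i : Fin n, (if i.val < k then w i else 0) - ∑ i : Fin n, (if i.val < k then a else 0) := by
    intro w
    rw [← Finset.sum_sub_distrib]
    refine Finset.sum_congr rfl fun i _ => ?_
    split_ifs <;> simp
  rw [split, split] at key
  linarith

end Sorting

section Cyclic

variable {d : ℕ} [NeZero d]

lemma sum_add_one {M : Type*} [AddCommMonoid M] (F : ZMod d → M) :
    ∑ σ, F (σ + 1) = ∑ σ, F σ :=
  Equiv.sum_comp (Equiv.addRight (1 : ZMod d)) F

lemma le_add_of_cyclic_step {g : ZMod d → ℝ} {C : ℝ} (hC : 0 ≤ C)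
    (h : ∀ σ, g σ ≤ g (σ + 1) + C) (σ τ : ZMod d) : g σ ≤ g τ + d * C := by
  have step : ∀ k : ℕ, g σ ≤ g (σ + k) + k * C := by
    intro k
    induction k with
    | zero => simp
    | succ k ih =>
      have := h (σ + k)
      push_cast
      rw [← add_assoc]
      linarith
  have h1 := step (τ - σ).val
  have h2 : ((τ - σ).val : ℝ) ≤ d := by exact_mod_cast (ZMod.val_lt (τ - σ)).le
  rw [ZMod.natCast_val, ZMod.cast_id, add_sub_cancel] at h1
  nlinarith

end Cyclic

section FixedPoint

variable {d n : ℕ}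

/-- One step of the cyclic process: translate by `v` and sort. -/
noncomputable def sortStep (v y : ZMod d → Fin n → ℝ) : ZMod d → Fin n → ℝ :=
  fun σ => sortTuple (y (σ + 1) + v (σ + 1))

lemma monotone_of_eq_smul_sortStep {v y : ZMod d → Fin n → ℝ} {t : ℝ} (h0 : 0 < t)
    (hy : y = t • sortStep v y) (σ : ZMod d) : Monotone (y σ) := by
  intro i j hij
  rw [hy]
  exact mul_le_mul_of_nonneg_left (sortTuple_monotone _ hij) h0.le

/-- Entries of consecutive tuples differ in a controlled way. -/
lemma exists_apply_eq_smul {v y : ZMod d → Fin n → ℝ} {t C : ℝ}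
    (hmono : ∀ σ, Monotone (y σ)) (hy : y = t • sortStep v y)
    (hC : ∀ σ i, |v σ i| ≤ C) (σ : ZMod d) (i : Fin n) :
    ∃ w, y σ i = t * w ∧ |w - y (σ + 1) i| ≤ C := by
  refine ⟨sortStep v y σ i, congrFun (congrFun hy σ) i, ?_⟩
  have hs := sortTuple_of_monotone (hmono (σ + 1))
  rw [abs_sub_le_iff]
  constructor
  · have := sortTuple_le_add (x := y (σ + 1) + v (σ + 1)) (y := y (σ + 1)) (δ := C)
      (fun j => by simpa using (abs_le.1 (hC (σ + 1) j)).2) i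
    rw [hs] at this
    simp only [sortStep]; linarith
  · have := sortTuple_le_add (x := y (σ + 1)) (y := y (σ + 1) + v (σ + 1)) (δ := C)
      (fun j => by
        have := (abs_le.1 (hC (σ + 1) j)).1
        simp only [Pi.add_apply]; linarith) i
    rw [hs] at this
    simp only [sortStep]; linarith

variable [NeZero d]

lemma sortStep_lipschitz (v : ZMod d → Fin n → ℝ) : LipschitzWith 1 (sortStep v) := by
  refine LipschitzWith.of_dist_le_mul fun x y => ?_
  rw [NNReal.coe_one, one_mul]
  refine (dist_pi_le_iff dist_nonneg).2 fun σ => (dist_pi_le_iff dist_nonneg).2 fun i => ?_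
  have h : ∀ j, |x (σ + 1) j - y (σ + 1) j| ≤ dist x y := fun j =>
    (dist_le_pi_dist (x (σ + 1)) (y (σ + 1)) j).trans (dist_le_pi_dist x y (σ + 1))
  rw [Real.dist_eq, abs_sub_le_iff]
  constructor
  · have := sortTuple_le_add (x := x (σ + 1) + v (σ + 1)) (y := y (σ + 1) + v (σ + 1))
      (δ := dist x y) (fun j => by
        have := (abs_sub_le_iff.1 (h j)).1
        simp only [Pi.add_apply]; linarith) i
    simp only [sortStep]; linarith
  · have := sortTuple_le_add (x := y (σ + 1) + v (σ + 1)) (y := x (σ + 1) + v (σ + 1))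
      (δ := dist x y) (fun j => by
        have := (abs_sub_le_iff.1 (h j)).2
        simp only [Pi.add_apply]; linarith) i
    simp only [sortStep]; linarith

lemma exists_eq_smul_sortStep (v : ZMod d → Fin n → ℝ) {t : ℝ} (h0 : 0 < t) (h1 : t < 1) :
    ∃ y, y = t • sortStep v y := by
  have hc : ContractingWith ⟨t, h0.le⟩ (fun y => t • sortStep v y) := by
    refine ⟨by exact_mod_cast h1, LipschitzWith.of_dist_le_mul fun x y => ?_⟩
    rw [dist_smul₀, Real.norm_of_nonneg h0.le]
    have := (sortStep_lipschitz v).dist_le_mul x y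
    rw [NNReal.coe_one, one_mul] at this
    exact mul_le_mul_of_nonneg_left this h0.le
  exact ⟨_, hc.fixedPoint_isFixedPt.symm⟩

section Bounds

variable {v y : ZMod d → Fin n → ℝ} {t C : ℝ}

lemma sum_eq_zero_of_eq_smul_sortStep (h1 : t < 1) (hy : y = t • sortStep v y)
    (hv : ∑ σ, ∑ i, v σ i = 0) : ∑ σ, ∑ i, y σ i = 0 := by
  have h : ∑ σ, ∑ i, y σ i = t * ∑ σ, ∑ i, y σ i := by
    calc ∑ σ, ∑ i, y σ i = ∑ σ, t * ∑ i, (y (σ + 1) i + v (σ + 1) i) := by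
          refine Finset.sum_congr rfl fun σ _ => ?_
          conv_lhs => rw [hy]
          simp only [Pi.smul_apply, smul_eq_mul, sortStep, ← Finset.mul_sum, sum_sortTuple,
            Pi.add_apply]
      _ = t * ∑ σ, ∑ i, (y σ i + v σ i) := by
          rw [← Finset.mul_sum, sum_add_one (fun σ => ∑ i, (y σ i + v σ i))]
      _ = t * ∑ σ, ∑ i, y σ i := by
          simp only [Finset.sum_add_distrib, hv, add_zero]
  have h2 : (1 - t) * ∑ σ, ∑ i, y σ i = 0 := by linarith
  exact (mul_eq_zero.1 h2).resolve_left (by linarith)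

lemma initial_sum_lt {x : Fin n → ℝ} (hx : Monotone x) {k : ℕ} (hk : k + 1 < n)
    (hgap : x ⟨k, by omega⟩ < x ⟨k + 1, hk⟩) :
    (n : ℝ) * ∑ i : Fin n, (if i.val < k + 1 then x i else 0) < (k + 1) * ∑ i, x i := by
  set a := x ⟨k, by omega⟩ with ha
  have hL : ∑ i : Fin n, (if i.val < k + 1 then x i - a else 0) ≤ 0 := by
    refine Finset.sum_nonpos fun i _ => ?_
    split_ifs with hi
    · exact sub_nonpos.2 (hx (Fin.mk_le_mk.2 (by omega)))
    · exact le_rfl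
  have hU : 0 < ∑ i : Fin n, (if i.val < k + 1 then 0 else x i - a) := by
    refine Finset.sum_pos' (fun i _ => ?_) ⟨⟨k + 1, hk⟩, Finset.mem_univ _, ?_⟩
    · split_ifs with hi
      · exact le_rfl
      · exact sub_nonneg.2 (hx (Fin.mk_le_mk.2 (by omega)))
    · simp only [lt_irrefl, if_false]; linarith
  have hcard : ∑ i : Fin n, (if i.val < k + 1 then a else 0) = (k + 1) * a := by
    have : (Finset.univ.filter fun i : Fin n => i.val < k + 1).card = k + 1 := by
      rw [Fin.card_filter_val_lt]; omega
    rw [← Finset.sum_filter, Finset.sum_const, this]; simp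
  have e1 : ∑ i : Fin n, (if i.val < k + 1 then x i - a else 0) =
      ∑ i : Fin n, (if i.val < k + 1 then x i else 0) - (k + 1) * a := by
    rw [← hcard, ← Finset.sum_sub_distrib]
    refine Finset.sum_congr rfl fun i _ => ?_
    split_ifs <;> simp
  have e2 : ∑ i : Fin n, (if i.val < k + 1 then 0 else x i - a) =
      ∑ i, x i - n * a - ∑ i : Fin n, (if i.val < k + 1 then x i - a else 0) := by
    have : (n : ℝ) * a = ∑ _i : Fin n, a := by simp
    rw [this, ← Finset.sum_sub_distrib, ← Finset.sum_sub_distrib]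
    refine Finset.sum_congr rfl fun i _ => ?_
    split_ifs <;> simp
  have hkn : (k : ℝ) + 1 < n := by exact_mod_cast hk
  have hk0 : (0 : ℝ) ≤ k := Nat.cast_nonneg k
  rw [e2] at hU
  rw [e1] at hU hL
  nlinarith

/-- Some consecutive gap at position `k` is small. -/
lemma exists_gap_le (h0 : 0 < t) (h1 : t < 1) (hy : y = t • sortStep v y)
    (hv : ∑ σ, ∑ i, v σ i = 0) (hC : ∀ σ i, |v σ i| ≤ C) (hC0 : 0 < C) {k : ℕ} (hk : k + 1 < n)
    (hvk : 0 ≤ ∑ σ, ∑ i : Fin n, if i.val < k + 1 then v σ i else 0) :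
    ∃ σ, y σ ⟨k + 1, hk⟩ - y σ ⟨k, by omega⟩ ≤ 2 * C := by
  by_contra! hcon
  have hmono := monotone_of_eq_smul_sortStep h0 hy
  have hlt : (n : ℝ) * ∑ σ, ∑ i : Fin n, (if i.val < k + 1 then y σ i else 0) < 0 := by
    have := sum_eq_zero_of_eq_smul_sortStep h1 hy hv
    calc (n : ℝ) * ∑ σ, ∑ i : Fin n, (if i.val < k + 1 then y σ i else 0)
        < (k + 1) * ∑ σ, ∑ i, y σ i := by
          rw [Finset.mul_sum, Finset.mul_sum]
          exact Finset.sum_lt_sum_of_nonempty Finset.univ_nonempty fun σ _ =>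
            initial_sum_lt (hmono σ) hk (by linarith [hcon σ])
      _ = 0 := by rw [this, mul_zero]
  have hge : t * (∑ σ, ∑ i : Fin n, (if i.val < k + 1 then y σ i else 0) +
      ∑ σ, ∑ i : Fin n, (if i.val < k + 1 then v σ i else 0)) ≤
      ∑ σ, ∑ i : Fin n, (if i.val < k + 1 then y σ i else 0) := by
    calc _ = t * ∑ σ, ∑ i : Fin n, (if i.val < k + 1 then (y σ + v σ) i else 0) := by
          rw [← Finset.sum_add_distrib]
          congr 1
          refine Finset.sum_congr rfl fun σ _ => ?_
          rw [← Finset.sum_add_distrib]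
          refine Finset.sum_congr rfl fun i _ => ?_
          split_ifs <;> simp
      _ = t * ∑ σ, ∑ i : Fin n,
            (if i.val < k + 1 then (y (σ + 1) + v (σ + 1)) i else 0) := by
          rw [sum_add_one (fun σ => ∑ i : Fin n, (if i.val < k + 1 then (y σ + v σ) i else 0))]
      _ ≤ t * ∑ σ, ∑ i : Fin n, (if i.val < k + 1 then sortStep v y σ i else 0) := by
          refine mul_le_mul_of_nonneg_left (Finset.sum_le_sum fun σ _ => ?_) h0.le
          refine sum_initial_le_sum_sortTuple (a := y (σ + 1) ⟨k, by omega⟩ + C) ?_ ?_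
          · intro i hi
            have := hmono (σ + 1) (show i ≤ ⟨k, by omega⟩ from Fin.mk_le_mk.2 (by omega))
            simp only [Pi.add_apply]
            linarith [(abs_le.1 (hC (σ + 1) i)).2]
          · intro i hi
            have := hmono (σ + 1) (show ⟨k + 1, hk⟩ ≤ i from Fin.mk_le_mk.2 (by omega))
            simp only [Pi.add_apply]
            linarith [(abs_le.1 (hC (σ + 1) i)).1, hcon (σ + 1)]
      _ = _ := by
          rw [Finset.mul_sum]
          refine Finset.sum_congr rfl fun σ _ => ?_
          rw [Finset.mul_sum]
          refine Finset.sum_congr rfl fun i _ => ?_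
          conv_rhs => rw [hy]
          simp [Pi.smul_apply]
  have hn0 : (0 : ℝ) < n := by exact_mod_cast (by omega : 0 < n)
  have hneg : ∑ σ, ∑ i : Fin n, (if i.val < k + 1 then y σ i else 0) < 0 := by
    by_contra! hcon2
    nlinarith
  nlinarith

lemma gap_le (h0 : 0 < t) (h1 : t < 1) (hy : y = t • sortStep v y)
    (hv : ∑ σ, ∑ i, v σ i = 0) (hC : ∀ σ i, |v σ i| ≤ C) (hC0 : 0 < C) {k : ℕ} (hk : k + 1 < n)
    (hvk : 0 ≤ ∑ σ, ∑ i : Fin n, if i.val < k + 1 then v σ i else 0) (σ : ZMod d) :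
    y σ ⟨k + 1, hk⟩ - y σ ⟨k, by omega⟩ ≤ 2 * C + d * (2 * C) := by
  have hmono := monotone_of_eq_smul_sortStep h0 hy
  obtain ⟨τ, hτ⟩ := exists_gap_le h0 h1 hy hv hC hC0 hk hvk
  have hstep := le_add_of_cyclic_step (g := fun σ => y σ ⟨k + 1, hk⟩ - y σ ⟨k, by omega⟩)
    (C := 2 * C) (by linarith) (fun ρ => ?_) σ τ
  · linarith
  · obtain ⟨w, hw, hw'⟩ := exists_apply_eq_smul hmono hy hC ρ ⟨k + 1, hk⟩
    obtain ⟨u, hu, hu'⟩ := exists_apply_eq_smul hmono hy hC ρ ⟨k, by omega⟩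
    have hle : u ≤ w := by
      have := hmono ρ (show (⟨k, by omega⟩ : Fin n) ≤ ⟨k + 1, hk⟩ from Fin.mk_le_mk.2 (by omega))
      rw [hw, hu] at this
      exact le_of_mul_le_mul_left this h0
    rw [abs_le] at hw' hu'
    simp only [hw, hu]
    nlinarith

lemma abs_le_of_eq_smul_sortStep (h0 : 0 < t) (h1 : t < 1) (hy : y = t • sortStep v y)
    (hv : ∑ σ, ∑ i, v σ i = 0) (hC : ∀ σ i, |v σ i| ≤ C) (hC0 : 0 < C)
    (hvk : ∀ k ≤ n, 0 ≤ ∑ σ, ∑ i : Fin n, if i.val < k then v σ i else 0)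
    (σ : ZMod d) (i : Fin n) :
    |y σ i| ≤ d * C + n * (2 * C + d * (2 * C)) := by
  have hmono := monotone_of_eq_smul_sortStep h0 hy
  have htot := sum_eq_zero_of_eq_smul_sortStep h1 hy hv
  have hn : 0 < n := i.pos
  set G := 2 * C + d * (2 * C) with hG
  have hG0 : 0 ≤ G := by positivity
  have hspread : ∀ σ, ∀ k (hk : k < n), y σ ⟨k, hk⟩ ≤ y σ ⟨0, hn⟩ + k * G := by
    intro σ k
    induction k with
    | zero => intro _; simp
    | succ k ih =>
      intro hk
      have := gap_le h0 h1 hy hv hC hC0 hk (hvk (k + 1) hk.le) σ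
      push_cast
      linarith [ih (by omega)]
  have hspread' : ∀ σ i j, y σ j ≤ y σ i + n * G := by
    intro σ i j
    have hj := hspread σ j j.isLt
    have hi := hmono σ (show ⟨0, hn⟩ ≤ i from Fin.mk_le_mk.2 (by omega))
    have : (j : ℝ) * G ≤ n * G :=
      mul_le_mul_of_nonneg_right (by exact_mod_cast j.isLt.le) hG0
    linarith
  have hlow : ∃ σ i, y σ i ≤ 0 := by
    by_contra! hcon
    have : 0 < ∑ σ, ∑ i, y σ i := Finset.sum_pos
      (fun σ _ => Finset.sum_pos (fun i _ => hcon σ i) ⟨i, Finset.mem_univ i⟩)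
      Finset.univ_nonempty
    linarith
  have hhigh : ∃ σ i, 0 ≤ y σ i := by
    by_contra! hcon
    have : ∑ σ, ∑ i, y σ i < 0 := Finset.sum_neg
      (fun σ _ => Finset.sum_neg (fun i _ => hcon σ i) ⟨i, Finset.mem_univ i⟩)
      Finset.univ_nonempty
    linarith
  obtain ⟨τ, j, hj⟩ := hlow
  obtain ⟨τ', j', hj'⟩ := hhigh
  have hup := le_add_of_cyclic_step (g := fun σ => max (y σ j) 0) hC0.le (fun ρ => ?_) σ τ
  have hdown := le_add_of_cyclic_step (g := fun σ => max (-y σ j') 0) hC0.le (fun ρ => ?_) σ τ'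
  · simp only [max_eq_right hj] at hup
    rw [max_eq_right (by linarith : -y τ' j' ≤ 0)] at hdown
    rw [abs_le]
    constructor
    · linarith [le_max_left (-y σ j') 0, hspread' σ i j']
    · linarith [le_max_left (y σ j) 0, hspread' σ j i]
  · obtain ⟨w, hw, hw'⟩ := exists_apply_eq_smul hmono hy hC ρ j'
    rw [abs_le] at hw'
    have hm := le_max_left (-y (ρ + 1) j') 0
    have hm' := le_max_right (-y (ρ + 1) j') 0
    refine max_le ?_ (by linarith)
    rw [hw]
    nlinarith
  · obtain ⟨w, hw, hw'⟩ := exists_apply_eq_smul hmono hy hC ρ j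
    rw [abs_le] at hw'
    have hm := le_max_left (y (ρ + 1) j) 0
    have hm' := le_max_right (y (ρ + 1) j) 0
    refine max_le ?_ (by linarith)
    rw [hw]
    nlinarith

end Bounds

lemma exists_sortStep_fixed (v : ZMod d → Fin n → ℝ) (hv : ∑ σ, ∑ i, v σ i = 0)
    (hvk : ∀ k ≤ n, 0 ≤ ∑ σ, ∑ i : Fin n, if i.val < k then v σ i else 0) :
    ∃ y, sortStep v y = y := by
  set C := ‖v‖ + 1 with hCdef
  have hC0 : 0 < C := by positivity
  have hC : ∀ σ i, |v σ i| ≤ C := fun σ i =>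
    ((norm_le_pi_norm (v σ) i).trans (norm_le_pi_norm v σ)).trans (by linarith)
  set R := d * C + n * (2 * C + d * (2 * C)) with hR
  have hR0 : 0 ≤ R := by positivity
  have hcont : Continuous fun y => dist y (sortStep v y) :=
    continuous_id.dist (sortStep_lipschitz v).continuous
  obtain ⟨y, -, hymin⟩ := (isCompact_closedBall (0 : ZMod d → Fin n → ℝ) R).exists_isMinOn
    ⟨0, by simpa using hR0⟩ hcont.continuousOn
  refine ⟨y, (dist_le_zero.1 ?_).symm⟩
  set K := R + ‖sortStep v 0‖ with hK
  have hK0 : 0 ≤ K := by positivity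
  refine le_of_forall_pos_le_add fun δ hδ => ?_
  set ε := min (1 / 2) (δ / (K + 1)) with hε
  have hε0 : 0 < ε := by positivity
  have hε1 : ε < 1 := (min_le_left _ _).trans_lt (by norm_num)
  obtain ⟨z, hz⟩ := exists_eq_smul_sortStep v (t := 1 - ε) (by linarith) (by linarith)
  have hzR : ‖z‖ ≤ R := (pi_norm_le_iff_of_nonneg hR0).2 fun σ =>
    (pi_norm_le_iff_of_nonneg hR0).2 fun i =>
      abs_le_of_eq_smul_sortStep (by linarith) (by linarith) hz hv hC hC0 hvk σ i
  have hmin : dist y (sortStep v y) ≤ dist z (sortStep v z) :=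
    hymin (by simpa using hzR)
  have hT : ‖sortStep v z‖ ≤ K := by
    have h := (sortStep_lipschitz v).dist_le_mul z 0
    rw [NNReal.coe_one, one_mul, dist_zero_right, dist_eq_norm] at h
    have := norm_add_le (sortStep v z - sortStep v 0) (sortStep v 0)
    rw [sub_add_cancel] at this
    linarith
  have hdist : dist z (sortStep v z) = ε * ‖sortStep v z‖ := by
    rw [dist_eq_norm]
    have : z - sortStep v z = -(ε • sortStep v z) := by
      conv_lhs => enter [1]; rw [hz]
      rw [sub_smul, one_smul]; abel
    rw [this, norm_neg, norm_smul, Real.norm_of_nonneg hε0.le]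
  have hle : ε * (K + 1) ≤ δ := by
    have := min_le_right (1 / 2) (δ / (K + 1))
    rw [← hε, le_div_iff₀ (by linarith)] at this
    exact this
  nlinarith

/-- Integral version: a cyclic family of tuples, each the sorted translate of the next one. -/
lemma exists_int_sort_fixed (v : ZMod d → Fin n → ℤ) (hv : ∑ σ, ∑ i, v σ i = 0)
    (hvk : ∀ k ≤ n, 0 ≤ ∑ σ, ∑ i : Fin n, if i.val < k then v σ i else 0) :
    ∃ y : ZMod d → Fin n → ℤ, ∀ σ, sortTuple (y (σ + 1) + v (σ + 1)) = y σ := by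
  obtain ⟨y, hy⟩ := exists_sortStep_fixed (fun σ i => (v σ i : ℝ)) (by exact_mod_cast hv)
    (fun k hk => by exact_mod_cast hvk k hk)
  refine ⟨fun σ i => ⌊y σ i⌋, fun σ => ?_⟩
  have h := sortTuple_floor (y (σ + 1) + fun i => (v (σ + 1) i : ℝ))
  simp only [Pi.add_apply, Int.floor_add_intCast] at h
  have h' := congrFun hy σ
  simp only [sortStep] at h'
  rw [h'] at h
  exact h

end FixedPoint

section Residues

variable {d n : ℕ} [NeZero d]

lemma sum_range_natCast_zmod {M : Type*} [AddCommMonoid M] (F : ZMod d → M) :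
    ∑ j ∈ Finset.range d, F j = ∑ σ, F σ := by
  refine Finset.sum_bij (fun j _ => (j : ZMod d)) (fun _ _ => Finset.mem_univ _) ?_ ?_
    (fun _ _ => rfl)
  · intro i hi j hj h
    have := congrArg ZMod.val h
    rwa [ZMod.val_natCast_of_lt (Finset.mem_range.1 hi),
      ZMod.val_natCast_of_lt (Finset.mem_range.1 hj)] at this
  · intro σ _
    exact ⟨σ.val, Finset.mem_range.2 (ZMod.val_lt σ), by simp⟩

lemma sum_fin_natCast_succ {M : Type*} [AddCommMonoid M] (F : ZMod d → M) :
    ∑ τ : Fin d, F ((τ.val + 1 : ℕ) : ZMod d) = ∑ σ, F σ := by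
  rw [← sum_add_one F, ← sum_range_natCast_zmod, Finset.sum_range]
  simp

lemma sum_range_mul_period {M : Type*} [AddCommMonoid M] (F : ZMod d → M) (k : ℕ) :
    ∑ j ∈ Finset.range (k * d), F j = k • ∑ σ, F σ := by
  induction k with
  | zero => simp
  | succ k ih =>
    rw [Nat.succ_mul, Finset.sum_range_add, ih, succ_nsmul, ← sum_range_natCast_zmod F]
    simp

/-- A non-empty set of residues which is stable under `f` contains all residues. -/
lemma mem_of_residues_stable {m : ℕ} (hn : 0 < n) (hmn : Nat.Coprime m n) {mfun : ZMod d → ℤ}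
    (hsum : ∑ τ, mfun τ = (m : ℤ)) {S : Set (ZMod d × ZMod n)} (hne : S.Nonempty)
    (hS : ∀ τ x, (τ, x) ∈ S → (τ + 1, x + (mfun τ : ZMod n)) ∈ S) (p : ZMod d × ZMod n) :
    p ∈ S := by
  have : NeZero n := ⟨hn.ne'⟩
  have iter : ∀ (k : ℕ) τ x, (τ, x) ∈ S →
      (τ + k, x + ∑ j ∈ Finset.range k, (mfun (τ + j) : ZMod n)) ∈ S := by
    intro k τ x h
    induction k with
    | zero => simpa using h
    | succ k ih =>
      have := hS _ _ ih
      rw [Finset.sum_range_succ]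
      push_cast
      rwa [← add_assoc, ← add_assoc]
  have period : ∀ τ x, (τ, x) ∈ S → (τ, x + (m : ZMod n)) ∈ S := by
    intro τ x h
    have h1 := iter d τ x h
    have h2 : ∑ j ∈ Finset.range d, (mfun (τ + j) : ZMod n) = (m : ZMod n) := by
      rw [sum_range_natCast_zmod (fun σ => (mfun (τ + σ) : ZMod n)),
        show ∑ σ, (mfun (τ + σ) : ZMod n) = ∑ σ, (mfun σ : ZMod n) from
          Equiv.sum_comp (Equiv.addLeft τ) fun σ => (mfun σ : ZMod n)]
      exact_mod_cast congrArg (Int.cast (R := ZMod n)) hsum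
    rwa [h2, ZMod.natCast_self, add_zero] at h1
  have multiples : ∀ (k : ℕ) τ x, (τ, x) ∈ S → (τ, x + k * (m : ZMod n)) ∈ S := by
    intro k τ x h
    induction k with
    | zero => simpa using h
    | succ k ih =>
      have := period _ _ ih
      push_cast
      rwa [add_mul, one_mul, ← add_assoc]
  obtain ⟨⟨τ, x⟩, h⟩ := hne
  obtain ⟨τ', z⟩ := p
  have h1 := iter (τ' - τ).val τ x h
  rw [ZMod.natCast_val, ZMod.cast_id, add_sub_cancel] at h1
  set x' := x + ∑ j ∈ Finset.range (τ' - τ).val, (mfun (τ + j) : ZMod n)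
  have h2 := multiples ((z - x') * (m : ZMod n)⁻¹).val τ' x' h1
  rwa [ZMod.natCast_val, ZMod.cast_id, mul_assoc, mul_comm _ (m : ZMod n),
    ZMod.coe_mul_inv_eq_one m hmn, mul_one, add_sub_cancel] at h2

end Residues

namespace ELChart

/-- `b τ` enumerates decreasingly a set of representatives of the residue classes modulo `n`,
and `f` maps the set of all `b τ j` onto the set of all `b τ i + n * ν τ i`. -/
structure IsEnumeration (d n : ℕ) (mfun : ZMod d → ℤ) (ν b : ZMod d → Fin n → ℤ) : Prop where
  strictAnti : ∀ τ, StrictAnti (b τ)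
  injective : ∀ τ, Function.Injective fun i => (b τ i : ZMod n)
  nonneg : ∀ τ i, 0 ≤ ν τ i
  exists_succ : ∀ τ j, ∃ i, b τ j + mfun τ = b (τ + 1) i + n * ν (τ + 1) i
  exists_pred : ∀ τ i, ∃ j, b (τ - 1) j + mfun (τ - 1) = b τ i + n * ν τ i

lemma exists_isEnumeration {d n m : ℕ} [NeZero d] (hn : 0 < n) (hmn : Nat.Coprime m n)
    {mfun : ZMod d → ℤ} (hsum : ∑ τ, mfun τ = (m : ℤ)) {ν : ZMod d → Fin n → ℤ}
    (hν : ∀ τ i, 0 ≤ ν τ i) (htot : ∑ τ, ∑ i, ν τ i = (m : ℤ))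
    (hpart : ∀ k ≤ n, (n : ℤ) * ∑ τ, ∑ i : Fin n, (if i.val < k then ν τ i else 0) ≤ k * m) :
    ∃ b, IsEnumeration d n mfun ν b := by
  have : NeZero n := ⟨hn.ne'⟩
  have hsum' : ∑ τ : ZMod d, mfun (τ - 1) = (m : ℤ) := by
    rw [← hsum]
    exact Equiv.sum_comp (Equiv.subRight (1 : ZMod d)) mfun
  have hcard : ∀ k ≤ n, ∀ c : ℤ, ∑ i : Fin n, (if i.val < k then c else 0) = k * c := by
    intro k hk c
    have : (Finset.univ.filter fun i : Fin n => i.val < k).card = k := by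
      rw [Fin.card_filter_val_lt]; omega
    rw [← Finset.sum_filter, Finset.sum_const, this]; simp
  obtain ⟨y, hy⟩ := exists_int_sort_fixed (fun τ i => mfun (τ - 1) - n * ν τ i)
    (by
      simp only [Finset.sum_sub_distrib, ← Finset.mul_sum, htot, Finset.sum_const,
        Finset.card_univ, Fintype.card_fin, nsmul_eq_mul, hsum', sub_self])
    (fun k hk => by
      have : ∀ τ, ∑ i : Fin n, (if i.val < k then mfun (τ - 1) - n * ν τ i else 0) =
          k * mfun (τ - 1) - n * ∑ i : Fin n, (if i.val < k then ν τ i else 0) := by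
        intro τ
        rw [← hcard k hk, Finset.mul_sum, ← Finset.sum_sub_distrib]
        refine Finset.sum_congr rfl fun i _ => ?_
        split_ifs <;> simp
      simp only [this, Finset.sum_sub_distrib, ← Finset.mul_sum, hsum']
      linarith [hpart k hk])
  have hperm : ∀ σ, ∃ π : Equiv.Perm (Fin n), ∀ i,
      y σ i = y (σ + 1) (π i) + (mfun σ - n * ν (σ + 1) (π i)) := by
    intro σ
    refine ⟨Tuple.sort (y (σ + 1) + fun i => mfun (σ + 1 - 1) - n * ν (σ + 1) i), fun i => ?_⟩
    have := congrFun (hy σ) i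
    rw [← this, sortTuple, Function.comp_apply, Pi.add_apply, add_sub_cancel_right]
  choose π hπ using hperm
  have hinj : ∀ τ, Function.Injective fun i => ((-y τ i : ℤ) : ZMod n) := by
    intro τ
    have hsurj : Function.Surjective fun i => ((-y τ i : ℤ) : ZMod n) := by
      intro x
      refine mem_of_residues_stable (S := {p | ∃ i, ((-y p.1 i : ℤ) : ZMod n) = p.2}) hn hmn hsum
        ⟨(0, ((-y 0 ⟨0, hn⟩ : ℤ) : ZMod n)), ⟨0, hn⟩, rfl⟩ ?_ (τ, x)
      rintro σ z ⟨i, hi⟩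
      refine ⟨π σ i, ?_⟩
      simp only [hπ σ i] at hi
      simp only [← hi]
      push_cast
      simp
    exact ((Fintype.bijective_iff_surjective_and_card _).2 ⟨hsurj, by simp [ZMod.card]⟩).1
  refine ⟨fun τ i => -y τ i, ⟨fun τ => ?_, hinj, hν, ?_, ?_⟩⟩
  · have hanti : Antitone fun i => -y τ i := fun i j hij => by
      rw [← hy τ]
      exact neg_le_neg (sortTuple_monotone _ hij)
    exact hanti.strictAnti_of_injective fun i j h =>
      hinj τ (congrArg (Int.cast (R := ZMod n)) h)
  · intro τ j
    refine ⟨π τ j, ?_⟩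
    rw [hπ τ j]; ring
  · intro τ i
    obtain ⟨j, rfl⟩ := (π (τ - 1)).surjective i
    refine ⟨j, ?_⟩
    have := hπ (τ - 1) j
    rw [sub_add_cancel] at this
    simp only [this]; ring

/-- The EL-chart generated by the elements `b τ i`. -/
def chartOf {d n : ℕ} (b : ZMod d → Fin n → ℤ) : Set (ZMod d × ℤ) :=
  {p | ∃ (i : Fin n) (k : ℕ), p.2 = b p.1 i + k * n}

namespace IsEnumeration

variable {d n : ℕ} {mfun : ZMod d → ℤ} {ν b : ZMod d → Fin n → ℤ}

lemma eq_of_dvd_sub (h : IsEnumeration d n mfun ν b) {τ : ZMod d} {i j : Fin n}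
    (hd : (n : ℤ) ∣ b τ i - b τ j) : i = j := by
  refine h.injective τ ?_
  have := (ZMod.intCast_zmod_eq_zero_iff_dvd _ n).2 hd
  push_cast at this
  exact sub_eq_zero.1 this

lemma isChart [NeZero d] (hn : 0 < n) (h : IsEnumeration d n mfun ν b) :
    IsChart d n mfun (chartOf b) := by
  refine ⟨⟨(0, b 0 ⟨0, hn⟩), ⟨0, hn⟩, 0, by simp⟩, ?_, ?_, ?_⟩
  · obtain ⟨c, hc⟩ := (Set.finite_range fun p : ZMod d × Fin n => b p.1 p.2).bddBelow
    refine ⟨c, ?_⟩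
    rintro p ⟨i, k, hp⟩
    have : c ≤ b p.1 i := hc ⟨(p.1, i), rfl⟩
    have : (0 : ℤ) ≤ k * n := by positivity
    linarith
  · rintro ⟨τ, x⟩ ⟨j, k, hp⟩
    obtain ⟨i, hi⟩ := h.exists_succ τ j
    refine ⟨i, k + (ν (τ + 1) i).toNat, ?_⟩
    have := Int.toNat_of_nonneg (h.nonneg (τ + 1) i)
    push_cast
    simp only at hp ⊢
    rw [this, hp]
    linarith
  · rintro ⟨τ, x⟩ ⟨j, k, hp⟩
    refine ⟨j, k + 1, ?_⟩
    simp only at hp ⊢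
    rw [hp]; push_cast; ring

lemma mem_Bset_iff (hn : 0 < n) (h : IsEnumeration d n mfun ν b) {τ : ZMod d} {x : ℤ} :
    (τ, x) ∈ Bset d n (chartOf b) ↔ ∃ i, x = b τ i := by
  constructor
  · rintro ⟨⟨i, k, hx⟩, hnot⟩
    simp only at hx
    cases k with
    | zero => exact ⟨i, by simpa using hx⟩
    | succ k =>
      refine absurd ⟨i, k, ?_⟩ hnot
      simp only [hx]; push_cast; ring
  · rintro ⟨i, rfl⟩
    refine ⟨⟨i, 0, by simp⟩, ?_⟩
    rintro ⟨j, k, hj⟩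
    simp only at hj
    obtain rfl : i = j := h.eq_of_dvd_sub ⟨k + 1, by linarith⟩
    have : (0 : ℤ) < (k + 1) * n := by positivity
    linarith

/-- Each term of the sequence `b_k` lies in `B`, and consecutive terms satisfy
`b_{k+1} = f(b_k) - c * n` with `c` non-negative. -/
lemma bseq_succ (hn : 0 < n) (h : IsEnumeration d n mfun ν b) {k : ℕ} {τ : ZMod d} {j : Fin n}
    (hk : bseq d n mfun (chartOf b) k = (τ, b τ j)) :
    ∃ i, bseq d n mfun (chartOf b) (k + 1) = (τ + 1, b (τ + 1) i) ∧
      b τ j + mfun τ = b (τ + 1) i + n * ν (τ + 1) i := by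
  obtain ⟨i, hi⟩ := h.exists_succ τ j
  refine ⟨i, ?_, hi⟩
  simp only [bseq, hk, h.mem_Bset_iff hn]
  refine Prod.ext rfl ?_
  simp only
  convert csInf_singleton (b (τ + 1) i) using 2
  ext y
  simp only [Set.mem_ofPred_eq, Set.mem_singleton_iff]
  constructor
  · rintro ⟨⟨i', rfl⟩, hmod, -⟩
    rw [hi] at hmod
    have hd := Int.dvd_of_emod_eq_zero hmod
    rw [add_sub_right_comm, Int.dvd_add_left (Dvd.intro _ rfl)] at hd
    rw [h.eq_of_dvd_sub hd]
  · rintro rfl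
    refine ⟨⟨i, rfl⟩, ?_, ?_⟩
    · rw [hi, add_sub_cancel_left, Int.mul_emod_right]
    · rw [hi]
      have := h.nonneg (τ + 1) i
      have : (0 : ℤ) ≤ n * ν (τ + 1) i := by positivity
      linarith

lemma exists_bseq_zero (hn : 0 < n) (h : IsEnumeration d n mfun ν b) :
    ∃ i, bseq d n mfun (chartOf b) 0 = (0, b 0 i) ∧ ∀ j, b 0 i ≤ b 0 j := by
  have hmin : ∀ j : Fin n, b 0 ⟨n - 1, by omega⟩ ≤ b 0 j := fun j =>
    (h.strictAnti 0).antitone (Fin.mk_le_mk.2 (by omega))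
  refine ⟨⟨n - 1, by omega⟩, Prod.ext rfl ?_, hmin⟩
  refine IsLeast.csInf_eq ⟨(h.mem_Bset_iff hn).2 ⟨_, rfl⟩, ?_⟩
  intro x hx
  obtain ⟨j, rfl⟩ := (h.mem_Bset_iff hn).1 hx
  exact hmin j

lemma exists_bseq_eq (hn : 0 < n) (h : IsEnumeration d n mfun ν b) (k : ℕ) :
    ∃ i, bseq d n mfun (chartOf b) k = ((k : ZMod d), b k i) := by
  induction k with
  | zero =>
    obtain ⟨i, hi, -⟩ := h.exists_bseq_zero hn
    exact ⟨i, by simpa using hi⟩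
  | succ k ih =>
    obtain ⟨j, hj⟩ := ih
    obtain ⟨i, hi, -⟩ := h.bseq_succ hn hj
    exact ⟨i, by simpa using hi⟩

lemma typeInt_succ (hn : 0 < n) (h : IsEnumeration d n mfun ν b) (k : ℕ) :
    0 ≤ typeInt d n mfun (chartOf b) (k + 1) ∧
      (n : ℤ) * typeInt d n mfun (chartOf b) (k + 1) =
        (bseq d n mfun (chartOf b) k).2 + mfun k - (bseq d n mfun (chartOf b) (k + 1)).2 := by
  obtain ⟨j, hj⟩ := h.exists_bseq_eq hn k
  obtain ⟨i, hi, hji⟩ := h.bseq_succ hn hj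
  have hn' : (n : ℤ) ≠ 0 := by exact_mod_cast hn.ne'
  have ht : typeInt d n mfun (chartOf b) (k + 1) = ν (k + 1) i := by
    rw [typeInt, Nat.add_sub_cancel, hi, hj]
    simp only [hji, add_sub_cancel_left]
    exact Int.mul_ediv_cancel_left _ hn'
  rw [ht, hi, hj]
  exact ⟨h.nonneg _ _, by simp only; linarith⟩

lemma mul_sum_typeInt (hn : 0 < n) (h : IsEnumeration d n mfun ν b) (N : ℕ) :
    (n : ℤ) * ∑ j ∈ Finset.range N, typeInt d n mfun (chartOf b) (j + 1) =
      (bseq d n mfun (chartOf b) 0).2 - (bseq d n mfun (chartOf b) N).2 +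
        ∑ j ∈ Finset.range N, mfun j := by
  induction N with
  | zero => simp
  | succ N ih =>
    rw [Finset.sum_range_succ, Finset.sum_range_succ, mul_add, ih, (h.typeInt_succ hn N).2]
    ring

lemma sum_typeTup_eq {A : Set (ZMod d × ℤ)} {k : ℕ} (hk : k ≤ n) :
    ∑ τ : Fin d, ∑ i : Fin n, (if i.val + 1 ≤ k then typeTup d n mfun A τ i else 0) =
      ∑ j ∈ Finset.range (k * d), typeInt d n mfun A (j + 1) := by
  have hblock : ∀ k, ∑ j ∈ Finset.range (k * d), typeInt d n mfun A (j + 1) =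
      ∑ i ∈ Finset.range k, ∑ τ : Fin d, typeInt d n mfun A (τ.val + 1 + i * d) := by
    intro k
    induction k with
    | zero => simp
    | succ k ih =>
      rw [Nat.succ_mul, Finset.sum_range_add, ih, Finset.sum_range_succ]
      congr 1
      rw [Finset.sum_range]
      refine Finset.sum_congr rfl fun τ _ => ?_
      congr 1
      ring
  rw [hblock, Finset.sum_comm]
  have hfilter : (Finset.range n).filter (fun i => i + 1 ≤ k) = Finset.range k := by
    ext i
    simp only [Finset.mem_filter, Finset.mem_range]
    omega
  rw [← hfilter, Finset.sum_filter, Finset.sum_range]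
  refine Finset.sum_congr rfl fun i _ => ?_
  split_ifs <;> simp [typeTup]

lemma memP_typeTup [NeZero d] {m : ℕ} (hn : 0 < n) (hsum : ∑ τ, mfun τ = (m : ℤ))
    (h : IsEnumeration d n mfun ν b) : memP d n m (typeTup d n mfun (chartOf b)) := by
  have hn' : (n : ℤ) ≠ 0 := by exact_mod_cast hn.ne'
  obtain ⟨i₀, hi₀, hmin⟩ := h.exists_bseq_zero hn
  have hsumk : ∀ k : ℕ, (n : ℤ) * ∑ j ∈ Finset.range (k * d),
      typeInt d n mfun (chartOf b) (j + 1) =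
      b 0 i₀ - (bseq d n mfun (chartOf b) (k * d)).2 + k * m := by
    intro k
    rw [h.mul_sum_typeInt hn, sum_range_mul_period mfun, hsum, hi₀, nsmul_eq_mul]
  have hcomp : ∀ k : ℕ, ∃ i, (bseq d n mfun (chartOf b) (k * d)).2 = b 0 i := by
    intro k
    obtain ⟨i, hi⟩ := h.exists_bseq_eq hn (k * d)
    exact ⟨i, by rw [hi]; simp⟩
  refine ⟨fun τ i => ?_, fun k _ hk => ?_, ?_⟩
  · have := (h.typeInt_succ hn (τ.val + i.val * d)).1
    rwa [add_right_comm] at this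
  · rw [sum_typeTup_eq hk, hsumk]
    obtain ⟨i, hi⟩ := hcomp k
    linarith [hmin i]
  · obtain ⟨i, hi⟩ := hcomp n
    have hsn := hsumk n
    rw [hi] at hsn
    obtain rfl : i = i₀ := by
      refine (h.eq_of_dvd_sub (τ := 0) ?_).symm
      exact ⟨∑ j ∈ Finset.range (n * d), typeInt d n mfun (chartOf b) (j + 1) - m, by
        linarith⟩
    rw [sub_self, zero_add] at hsn
    rw [← mul_left_cancel₀ hn' hsn, ← sum_typeTup_eq le_rfl]
    refine Finset.sum_congr rfl fun τ _ => Finset.sum_congr rfl fun i _ => ?_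
    rw [if_pos (Nat.succ_le_of_lt i.isLt)]

lemma btilde_eq (hn : 0 < n) (h : IsEnumeration d n mfun ν b) (τ : ZMod d) (i : Fin n) :
    btilde d n (chartOf b) τ (i.val + 1) = b τ i := by
  have hcard : ∀ j : Fin n, Set.ncard {z : ℤ | (∃ l, z = b τ l) ∧ b τ j < z} = j.val := by
    intro j
    have : {z : ℤ | (∃ l, z = b τ l) ∧ b τ j < z} = b τ '' Set.Iio j := by
      ext z
      constructor
      · rintro ⟨⟨l, rfl⟩, hl⟩
        exact ⟨l, (h.strictAnti τ).lt_iff_gt.1 hl, rfl⟩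
      · rintro ⟨l, hl, rfl⟩
        exact ⟨⟨l, rfl⟩, h.strictAnti τ hl⟩
    rw [this, Set.ncard_image_of_injective _ (h.strictAnti τ).injective,
      Set.ncard_eq_toFinset_card']
    simp
  simp only [btilde, h.mem_Bset_iff hn, Nat.add_sub_cancel]
  convert csInf_singleton (b τ i) using 2
  ext y
  simp only [Set.mem_ofPred_eq, Set.mem_singleton_iff]
  constructor
  · rintro ⟨⟨j, rfl⟩, hj⟩
    rw [hcard] at hj
    rw [Fin.ext hj]
  · rintro rfl
    exact ⟨⟨i, rfl⟩, hcard i⟩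

lemma muOf_eq (hn : 0 < n) (h : IsEnumeration d n mfun ν b) (τ : ZMod d) (i : Fin n) :
    muOf d n mfun (chartOf b) (τ, b τ i) = ν τ i := by
  obtain ⟨j, hj⟩ := h.exists_pred τ i
  have hset : {y : ℤ | (∃ l, y = b (τ - 1) l) ∧
      (y + mfun (τ - 1) - b τ i) % (n : ℤ) = 0 ∧ b τ i ≤ y + mfun (τ - 1)} = {b (τ - 1) j} := by
    ext y
    simp only [Set.mem_ofPred_eq, Set.mem_singleton_iff]
    constructor
    · rintro ⟨⟨l, rfl⟩, hmod, -⟩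
      obtain ⟨c, hc⟩ := Int.dvd_of_emod_eq_zero hmod
      rw [h.eq_of_dvd_sub (τ := τ - 1) (i := l) (j := j) ⟨c - ν τ i, by linarith⟩]
    · rintro rfl
      refine ⟨⟨j, rfl⟩, ?_, ?_⟩
      · rw [hj, add_sub_cancel_left, Int.mul_emod_right]
      · have := h.nonneg τ i
        have : (0 : ℤ) ≤ n * ν τ i := by positivity
        linarith
  simp only [muOf, h.mem_Bset_iff hn, hset, csInf_singleton, hj, add_sub_cancel_left]
  exact Int.mul_ediv_cancel_left _ (by exact_mod_cast hn.ne')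

lemma cotypeTup_eq (hn : 0 < n) (h : IsEnumeration d n mfun ν b) :
    cotypeTup d n mfun (chartOf b) = fun τ i => ν ((τ.val + 1 : ℕ) : ZMod d) i := by
  ext τ i
  rw [cotypeTup, h.btilde_eq hn, h.muOf_eq hn]

end IsEnumeration

/-- Every element of `P_{m,n,d}` is the cotype of an EL-chart whose type lies in `P_{m,n,d}`. -/
lemma exists_isChart_cotypeTup_eq {d n m : ℕ} [NeZero d] (hn : 0 < n) (hmn : Nat.Coprime m n)
    {mfun : ZMod d → ℤ} (hsum : ∑ τ, mfun τ = (m : ℤ)) {ν : Fin d → Fin n → ℤ}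
    (hν : memP d n m ν) :
    ∃ A, IsChart d n mfun A ∧ memP d n m (typeTup d n mfun A) ∧ cotypeTup d n mfun A = ν := by
  obtain ⟨hpos, hpart, htot⟩ := hν
  set ν' : ZMod d → Fin n → ℤ := fun σ => ν ⟨(σ - 1).val, ZMod.val_lt _⟩ with hν'
  have hνν' : ∀ τ : Fin d, ν' ((τ.val + 1 : ℕ) : ZMod d) = ν τ := by
    intro τ
    simp only [hν']
    congr 1
    refine Fin.ext ?_
    simp only [Nat.cast_add, Nat.cast_one, add_sub_cancel_right]
    exact ZMod.val_natCast_of_lt τ.isLt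
  obtain ⟨b, hb⟩ := exists_isEnumeration (ν := ν') hn hmn hsum (fun σ i => hpos _ i)
    (by
      rw [← sum_fin_natCast_succ]
      simpa only [hνν'] using htot)
    (fun k hk => by
      rw [← sum_fin_natCast_succ]
      simp only [hνν']
      rcases Nat.eq_zero_or_pos k with rfl | hk0
      · simp
      · exact hpart k hk0 hk)
  refine ⟨chartOf b, hb.isChart hn, hb.memP_typeTup hn hsum, ?_⟩
  rw [hb.cotypeTup_eq hn]
  ext τ i
  exact congrFun (hνν' τ) i

lemma finite_memP (d n m : ℕ) : {μ | memP d n m μ}.Finite := by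
  refine (Set.finite_Icc (0 : Fin d → Fin n → ℤ) fun _ _ => (m : ℤ)).subset ?_
  rintro μ ⟨hpos, -, htot⟩
  refine ⟨fun τ i => hpos τ i, fun τ i => ?_⟩
  calc μ τ i ≤ ∑ i, μ τ i :=
        Finset.single_le_sum (f := fun i => μ τ i) (fun i _ => hpos τ i) (Finset.mem_univ i)
    _ ≤ ∑ τ, ∑ i, μ τ i :=
        Finset.single_le_sum (f := fun τ => ∑ i, μ τ i)
          (fun τ _ => Finset.sum_nonneg fun i _ => hpos τ i) (Finset.mem_univ τ)
    _ = m := htot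

end ELChart

open ELChart

/-- The map `ζ : P_{m,n,d} → P_{m,n,d}`, defined so that
`ζ (type A) = cotype A` for every EL-chart `A`, is a bijection. -/
theorem zeta_bijective
    (d n m : ℕ) [NeZero d] (hn : 0 < n) (hm : 0 < m) (hmn : Nat.Coprime m n)
    (mfun : ZMod d → ℤ) (hsum : ∑ τ : ZMod d, mfun τ = (m : ℤ))
    (ζ : (Fin d → Fin n → ℤ) → (Fin d → Fin n → ℤ))
    (hζ : ∀ A : Set (ZMod d × ℤ), IsChart d n mfun A →
      ζ (typeTup d n mfun A) = cotypeTup d n mfun A) :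
    Set.BijOn ζ {μ | memP d n m μ} {μ | memP d n m μ} := by
  have hfin := finite_memP d n m
  have hsub : {μ | memP d n m μ} ⊆ ζ '' {μ | memP d n m μ} := by
    intro ν hν
    obtain ⟨A, hA, htype, hcotype⟩ := exists_isChart_cotypeTup_eq hn hmn hsum hν
    exact ⟨_, htype, (hζ A hA).trans hcotype⟩
  have himage : {μ | memP d n m μ} = ζ '' {μ | memP d n m μ} :=
    Set.eq_of_subset_of_ncard_le hsub (Set.ncard_image_le hfin) (hfin.image ζ)
  refine ⟨fun μ hμ => himage ▸ Set.mem_image_of_mem ζ hμ, ?_, hsub⟩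
  exact Set.injOn_of_ncard_image_eq (by rw [← himage]) hfin
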